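/- Let n = 2m be even. For all 0 ≤ k ≤ m−2 and all j ≥ 0, the map H^j_{{0}}(⟨Pf^{−2k}⟩_D) → H^j_{{0}}(⟨Pf^{−2k−2}⟩_D) induced by the inclusion ⟨Pf^{−2k}⟩_D ⊆ ⟨Pf^{−2k−2}⟩_D is the zero map. -/

import Mathlib

/-!
Common setup: the polynomial ring `S = ℂ[x_{i,j}]` of the space
`X = ⋀² (ℂⁿ)*` of `n × n` complex skew-symmetric matrices, Pfaffians, the
`GL_n(ℂ)`-action, invariant ideals, Pfaffian varieties and their (radical)
vanishing ideals, local cohomology (Mathlib's `localCohomology`), the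
localization `S_Pf`, 𝒟-module spans in `S_Pf` (via the partial derivatives,
extended to `S_Pf` as derivations), Gaussian binomial coefficients, and
injective-hull data for `E = E(ℂ)`.
-/

open scoped BigOperators

noncomputable section

namespace SkewLC

/-- Indices `(i,j)` with `i < j`, labelling the variables `x_{i,j}`. -/
abbrev SkewIdx (n : ℕ) := {p : Fin n × Fin n // p.1 < p.2}

/-- `S = Sym(⋀² ℂ^n) ≅ ℂ[x_{i,j} : 1 ≤ i < j ≤ n]`. -/
abbrev PS (n : ℕ) := MvPolynomial (SkewIdx n) ℂ

/-- The `(i,j)` entry of the generic skew-symmetric matrix `(x_{i,j})`. -/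
def genEntry (n : ℕ) (i j : Fin n) : PS n :=
  if h : i < j then MvPolynomial.X ⟨(i, j), h⟩
  else if h' : j < i then - MvPolynomial.X ⟨(j, i), h'⟩
  else 0

/-- The Pfaffian of the principal `2r × 2r` block of the generic skew-symmetric
matrix (zero by convention if `2r > n`):
`Pf_r = (1/(2^r r!)) ∑_σ sign(σ) ∏_i x_{σ(2i-1) σ(2i)}`. -/
def pfBlock (n r : ℕ) : PS n :=
  if h : 2 * r ≤ n then
    (((2 ^ r * r.factorial : ℕ) : ℂ))⁻¹ •
      ∑ σ : Equiv.Perm (Fin (2 * r)),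
        (Equiv.Perm.sign σ : ℤ) •
          ∏ i : Fin r,
            genEntry n (Fin.castLE h (σ ⟨2 * i.1, by have := i.isLt; omega⟩))
              (Fin.castLE h (σ ⟨2 * i.1 + 1, by have := i.isLt; omega⟩))
  else 0

/-- The full `n × n` Pfaffian `Pf` (for `n` even). -/
def pfaffian (n : ℕ) : PS n := pfBlock n (n / 2)

/-- The action of an `n × n` matrix `g` on `S`, sending the generic
skew-symmetric matrix `X` to `g X gᵀ` (on variables,
`x_{ij} ↦ ∑_{a,b} g_{ia} g_{jb} x_{ab}`).  Restricted to invertible `g` this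
is the natural action of `GL_n(ℂ)` on `S`. -/
def glMap (n : ℕ) (g : Matrix (Fin n) (Fin n) ℂ) : PS n →ₐ[ℂ] PS n :=
  MvPolynomial.aeval fun p : SkewIdx n =>
    ∑ a : Fin n, ∑ b : Fin n, (g p.1.1 a * g p.1.2 b) • genEntry n a b

/-- `z : ℕ → ℕ` is a partition with at most `m` nonzero parts, recorded as the
(0-indexed) weakly decreasing sequence `z 0 ≥ z 1 ≥ ⋯`; so `z i` is the
`(i+1)`-st part `z_{i+1}` of the partition. -/
def IsPartition (m : ℕ) (z : ℕ → ℕ) : Prop :=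
  (∀ i j, i ≤ j → z j ≤ z i) ∧ ∀ i, m ≤ i → z i = 0

/-- The rectangular partition `a × b` (`a` parts equal to `b`). -/
def rect (a b : ℕ) : ℕ → ℕ := fun i => if i < a then b else 0

/-- The highest weight vector of the irreducible summand
`𝕊_{z^{(2)}} W ⊆ S`: the product `∏_i Pf_i^{z_i - z_{i+1}}` of powers of the
principal `2i × 2i` Pfaffians. -/
def hwVector (n : ℕ) (z : ℕ → ℕ) : PS n :=
  ∏ i ∈ Finset.range (n / 2), pfBlock n (i + 1) ^ (z i - z (i + 1))

/-- The `GL_n(ℂ)`-invariant ideal `I_z ⊆ S` generated by the irreducible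
subrepresentation `𝕊_{z^{(2)}} W` of `S`; since that irreducible is spanned by
the `GL`-orbit of its highest weight vector, `I_z` is the ideal generated by
the `GL_n(ℂ)`-orbit of `hwVector n z`. -/
def invIdeal (n : ℕ) (z : ℕ → ℕ) : Ideal (PS n) :=
  Ideal.span {f | ∃ g : Matrix.GeneralLinearGroup (Fin n) ℂ,
    f = glMap n g.val (hwVector n z)}

/-- The Pfaffian variety `O̅_k`: skew-symmetric `n × n` matrices of rank `≤ 2k`. -/
def rankVariety (n k : ℕ) : Set (Matrix (Fin n) (Fin n) ℂ) :=
  {A | A.transpose = -A ∧ A.rank ≤ 2 * k}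

/-- Evaluation of a polynomial in `S` at a matrix. -/
def evalMat (n : ℕ) (A : Matrix (Fin n) (Fin n) ℂ) : PS n →+* ℂ :=
  (MvPolynomial.aeval fun p : SkewIdx n => A p.1.1 p.1.2).toRingHom

/-- The (radical) vanishing ideal of the Pfaffian variety `O̅_k`; local
cohomology with support in `O̅_k` is local cohomology at this ideal. -/
def varIdeal (n k : ℕ) : Ideal (PS n) :=
  ⨅ A ∈ rankVariety n k, RingHom.ker (evalMat n A)

/-- The homogeneous maximal ideal `𝔪 ⊆ S` (the vanishing ideal of the origin);
`H^j_{{0}}(-) = H^j_𝔪(-)`. -/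
def mIdeal (n : ℕ) : Ideal (PS n) :=
  RingHom.ker (evalMat n 0)

/-- The Gaussian binomial coefficient evaluated at `q^e`,
`binom(a,b)_{q^e} ∈ ℤ[q] ⊆ ℚ[q]`, where
`binom(a,b)_q = ∏_{i=1}^{b} (1 - q^{a-b+i})/(1 - q^i)`.
(The polynomial division below is exact.) -/
def gaussBinom (a b e : ℕ) : Polynomial ℚ :=
  (∏ i ∈ Finset.range b, (1 - Polynomial.X ^ (e * (a - b + i + 1)))) /
    (∏ i ∈ Finset.range b, (1 - Polynomial.X ^ (e * (i + 1))))

/-- Data exhibiting `E` as the injective hull of `ℂ = S/𝔪` over `S`: an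
injective `S`-module together with an essential embedding of `S/𝔪`. -/
structure InjHullData (n : ℕ) where
  /-- the underlying module -/
  E : Type
  [addCommGroup : AddCommGroup E]
  [module : Module (PS n) E]
  injective : Module.Injective (PS n) E
  emb : (PS n ⧸ mIdeal n) →ₗ[PS n] E
  emb_injective : Function.Injective emb
  essential : ∀ N : Submodule (PS n) E, N ≠ ⊥ → N ⊓ LinearMap.range emb ≠ ⊥

attribute [instance] InjHullData.addCommGroup InjHullData.module

/-- `S_Pf`, the localization of `S` at the Pfaffian. -/
abbrev SPf (n : ℕ) : Type := Localization.Away (pfaffian n)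

/-- `Pf⁻¹ ∈ S_Pf`. -/
def pfInv (n : ℕ) : SPf n := IsLocalization.Away.invSelf (S := SPf n) (pfaffian n)

/-- An `S`-submodule of `S_Pf` is a `𝒟_X`-submodule iff it is stable under the
partial derivatives `∂/∂x_{ij}` (extended to `S_Pf`, as the family `δ`). -/
def DStable (n : ℕ) (δ : SkewIdx n → Derivation ℂ (SPf n) (SPf n))
    (N : Submodule (PS n) (SPf n)) : Prop :=
  ∀ p : SkewIdx n, ∀ x ∈ N, δ p x ∈ N

/-- `⟨v⟩_𝒟 ⊆ S_Pf`, the `𝒟_X`-submodule of `S_Pf` generated by `v`: the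
smallest `S`-submodule containing `v` and stable under all partial
derivatives. -/
def dSpan (n : ℕ) (δ : SkewIdx n → Derivation ℂ (SPf n) (SPf n)) (v : SPf n) :
    Submodule (PS n) (SPf n) :=
  sInf {N : Submodule (PS n) (SPf n) | v ∈ N ∧ DStable n δ N}

/-- The statement that `δ` is the family of partial derivatives `∂/∂x_{ij}` of
`S` extended to derivations of `S_Pf` (such an extension exists and is
unique). -/
def IsDerivExtension (n : ℕ) (δ : SkewIdx n → Derivation ℂ (SPf n) (SPf n)) : Prop :=
  ∀ (p : SkewIdx n) (f : PS n),
    δ p (algebraMap (PS n) (SPf n) f) = algebraMap (PS n) (SPf n) (MvPolynomial.pderiv p f)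

/-- For `n = 2m` and `0 ≤ p ≤ m - 1`, the indecomposable equivariant
`𝒟_X`-module `Q_p = S_Pf / ⟨Pf^{2(p-m+1)}⟩_𝒟 = S_Pf / ⟨Pf^{-2(m-1-p)}⟩_𝒟`. -/
abbrev QMod (n : ℕ) (δ : SkewIdx n → Derivation ℂ (SPf n) (SPf n)) (p : ℕ) :=
  SPf n ⧸ dSpan n δ (pfInv n ^ (2 * (n / 2 - 1 - p)))

/-- The `S`-submodule `𝒩_{k,e} = I_{(m-k) × e} ⊗_S 𝒫_{-e-2k} ⊆ S_Pf`
(`m = n/2`), i.e. the image of the invariant ideal `I_{(m-k) × e}` under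
multiplication by `Pf^{-e-2k}`. -/
def NMod (n k e : ℕ) : Submodule (PS n) (SPf n) :=
  Submodule.map
    ((LinearMap.mulLeft (PS n) (pfInv n ^ (e + 2 * k))).comp
      (Algebra.linearMap (PS n) (SPf n)))
    (invIdeal n (rect (n / 2 - k) e))

/-- The set `succ(z, l, m)` of partitions obtained from `z` by adding boxes in
row `l + 1` or higher (rows recorded 0-indexed: `y i > z i` for some
`l ≤ i < m`). -/
def succSet (m : ℕ) (z : ℕ → ℕ) (l : ℕ) : Set (ℕ → ℕ) :=
  {y | IsPartition m y ∧ (∀ i, z i ≤ y i) ∧ ∃ i, l ≤ i ∧ i < m ∧ z i < y i}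

/-- The ideal `I_{succ(z,l,m)} = ∑_{y ∈ succ(z,l,m)} I_y`. -/
def succIdeal (n : ℕ) (z : ℕ → ℕ) (l : ℕ) : Ideal (PS n) :=
  ⨆ y ∈ succSet (n / 2) z l, invIdeal n y

/-- The subquotient `J_{z,l} = I_z / I_{succ(z,l,m)}` of `S` (`m = n/2`). -/
abbrev JMod (n : ℕ) (z : ℕ → ℕ) (l : ℕ) :=
  ↥(invIdeal n z) ⧸
    Submodule.comap (invIdeal n z : Submodule (PS n) (PS n)).subtype
      (succIdeal n z l : Submodule (PS n) (PS n))

end SkewLC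

namespace SkewLC

section Helpers
open CategoryTheory Limits Opposite

section PartA
universe u
variable {R : Type u} [CommRing R]

/-- the natural transformation between Hom functors used to define `Ext`. -/
noncomputable abbrev yoT {N N' : ModuleCat.{u} R} (f : N ⟶ N') :=
  ((linearYoneda R (ModuleCat.{u} R)).map f).rightOp

lemma ext_map_eq {X N N' : ModuleCat.{u} R} (f : N ⟶ N') (j : ℕ) :
    ((Ext R (ModuleCat.{u} R) j).obj (op X)).map f =
      ((NatTrans.leftDerived (yoT f) j).app X).unop := rfl

lemma yoT_add_app {X N N' : ModuleCat.{u} R} (f g : N ⟶ N') (j : ℕ) :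
    (NatTrans.leftDerived (yoT (f + g)) j).app X =
      (NatTrans.leftDerived (yoT f) j).app X + (NatTrans.leftDerived (yoT g) j).app X := by
  have P := projectiveResolution X
  rw [P.leftDerived_app_eq, P.leftDerived_app_eq, P.leftDerived_app_eq]
  rw [← Preadditive.comp_add, ← Preadditive.add_comp, ← Functor.map_add]
  congr 3

lemma yo_aux {Z N N' : ModuleCat.{u} R} (r : R) (g : N ⟶ N') (x : Z ⟶ N) :
    x ≫ (r • g) = (r • 𝟙 Z) ≫ (x ≫ g) := by
  rw [Linear.comp_smul, Linear.smul_comp, Category.id_comp]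

lemma yoT_smul_app {X N N' : ModuleCat.{u} R} (r : R) (hr : r • 𝟙 X = 0) (g : N ⟶ N') (j : ℕ) :
    (NatTrans.leftDerived (yoT (r • g)) j).app X = 0 := by
  have P := projectiveResolution X
  have h0 := Functor.leftDerived_map_eq ((linearYoneda R (ModuleCat.{u} R)).obj N').rightOp j
    (r • 𝟙 X) (P := P) (Q := P) (r • 𝟙 P.complex) (by
      ext i
      simp only [Linear.smul_comp, Category.id_comp, HomologicalComplex.smul_f_apply,
        HomologicalComplex.comp_f, ChainComplex.single₀_map_f_zero]
      erw [Linear.comp_smul]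
      simp
      rfl)
  have h1 := Functor.leftDerived_map_eq ((linearYoneda R (ModuleCat.{u} R)).obj N').rightOp j
    (0 : X ⟶ X) (P := P) (Q := P) (0 : P.complex ⟶ P.complex) (by simp)
  rw [hr, h1, cancel_epi, cancel_mono, Functor.map_zero] at h0
  rw [P.leftDerived_app_eq]
  have : ((NatTrans.mapHomologicalComplex (yoT (r • g)) (ComplexShape.down ℕ)).app P.complex) =
     (((linearYoneda R (ModuleCat.{u} R)).obj N').rightOp.mapHomologicalComplex _).map
      (r • 𝟙 P.complex) ≫ ((NatTrans.mapHomologicalComplex (yoT g) _).app P.complex) := by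
    ext i
    apply Quiver.Hom.unop_inj
    ext x : 2
    exact yo_aux r g x
  rw [this, Functor.map_comp, ← Functor.comp_map, ← h0]
  erw [zero_comp, comp_zero]

lemma ext_map_zero_of_mem {X N N' : ModuleCat.{u} R} (I : Ideal R)
    (hI : ∀ r ∈ I, r • 𝟙 X = 0) (f : N ⟶ N')
    (hf : f.hom ∈ I • (⊤ : Submodule R (N →ₗ[R] N'))) (j : ℕ) :
    ((Ext R (ModuleCat.{u} R) j).obj (op X)).map f = 0 := by
  have key : ∀ h ∈ I • (⊤ : Submodule R (N →ₗ[R] N')),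
      (NatTrans.leftDerived (yoT (ModuleCat.ofHom h)) j).app X = 0 := by
    intro h hh
    induction hh using Submodule.smul_induction_on' with
    | smul r hr n hn =>
      exact yoT_smul_app r (hI r hr) (ModuleCat.ofHom n) j
    | add x hx y hy h1 h2 =>
      have := yoT_add_app (X := X) (ModuleCat.ofHom x) (ModuleCat.ofHom y) j
      rw [h1, h2, add_zero] at this
      exact this
  rw [ext_map_eq]
  have := key _ hf
  rw [ModuleCat.ofHom_hom] at this
  rw [this]; rfl

lemma quot_aux (I : Ideal R) (r : R) (hr : r ∈ I) (x : R ⧸ I) : r • x = 0 := by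
  obtain ⟨x, rfl⟩ := Ideal.Quotient.mk_surjective x
  change Ideal.Quotient.mk I (r * x) = 0
  rw [Ideal.Quotient.eq_zero_iff_mem]
  exact Ideal.mul_mem_right _ _ hr

lemma localCohomology_map_zero (I : Ideal R) (j : ℕ) {N N' : ModuleCat.{u} R} (f : N ⟶ N')
    (hf : ∀ t : ℕ, f.hom ∈ (I ^ t) • (⊤ : Submodule R (N →ₗ[R] N'))) :
    (localCohomology I j).map f = 0 := by
  have := localCohomology.hasColimitDiagram.{u, 0} (localCohomology.idealPowersDiagram I) j
  change (colimit (localCohomology.diagram (localCohomology.idealPowersDiagram I) j)).map f = 0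
  set D := localCohomology.diagram (localCohomology.idealPowersDiagram I) j
  have hc := isColimitOfPreserves ((evaluation _ _).obj N) (colimit.isColimit D)
  refine hc.hom_ext fun t => ?_
  have h2 := (colimit.ι D t).naturality f
  rw [comp_zero]
  refine h2.symm.trans ?_
  have : (D.obj t).map f = 0 := by
    refine ext_map_zero_of_mem (I ^ (unop (unop t))) ?_ f (hf _) j
    intro r hr
    apply ModuleCat.hom_ext
    apply LinearMap.ext
    intro x
    exact quot_aux (I ^ (unop (unop t))) r hr x
  rw [this, zero_comp]
end PartA

section PartA2
variable {R : Type*} [CommRing R] {L : Type*} [CommRing L] [Algebra R L]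

lemma mem_pow_smul_hom {J : Type*} [Fintype J] (I : Ideal R) (x : J → R) (y : J → L)
    (hx : ∀ j, x j ∈ I) (hxy : ∑ j, x j • y j = 1) (A N : Submodule R L)
    (hN : ∀ j, ∀ z ∈ N, y j * z ∈ N) (t : ℕ) (h : A →ₗ[R] N) :
    h ∈ (I ^ t) • (⊤ : Submodule R (A →ₗ[R] N)) := by
  induction t generalizing h with
  | zero => simp
  | succ t ih =>
    let g : J → (N →ₗ[R] N) := fun j =>
      (LinearMap.mulLeft R (y j)).restrict (fun z hz => hN j z hz)
    have : h = ∑ j, x j • (g j ∘ₗ h) := by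
      ext a
      simp only [LinearMap.coe_sum, Finset.sum_apply, LinearMap.smul_apply, LinearMap.comp_apply,
        AddSubmonoidClass.coe_finsetSum, Submodule.coe_smul]
      have h2 : ∀ j, ((g j (h a) : N) : L) = y j * (h a : L) := fun j => rfl
      simp only [h2]
      calc ((h a : N) : L) = 1 * h a := (one_mul _).symm
        _ = _ := by rw [← hxy, Finset.sum_mul]; simp
    rw [this]
    refine Submodule.sum_mem _ fun j _ => ?_
    rw [pow_succ', Submodule.mul_smul]
    exact Submodule.smul_mem_smul (hx j) (ih _)

lemma incl_mem_pow_smul_hom {J : Type*} [Fintype J] (I : Ideal R) (x : J → R) (y : J → L)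
    (hx : ∀ j, x j ∈ I) (hxy : ∑ j, x j • y j = 1) (A N A' : Submodule R L)
    (hN : ∀ j, ∀ z ∈ N, y j * z ∈ N) (h1 : A ≤ N) (h2 : N ≤ A') (h3 : A ≤ A') (t : ℕ) :
    Submodule.inclusion h3 ∈ (I ^ t) • (⊤ : Submodule R (A →ₗ[R] A')) := by
  have := mem_pow_smul_hom I x y hx hxy A N hN t (Submodule.inclusion h1)
  have h4 := Submodule.mem_map_of_mem (f := LinearMap.compRight R (Submodule.inclusion h2) (M := A)) this
  rw [Submodule.map_smul''] at h4
  exact Submodule.smul_mono le_rfl le_top h4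
end PartA2

section PartC
open MvPolynomial

variable {σ : Type*} {R : Type*} [CommRing R]

/-- product of factorials -/
def mfac (s : σ →₀ ℕ) : ℕ := s.prod fun _ e => e.factorial

lemma mfac_add_single (s : σ →₀ ℕ) (i : σ) :
    mfac (s + Finsupp.single i 1) = mfac s * (s i + 1) := by
  classical
  unfold mfac
  have h1 := Finsupp.mul_prod_erase' (s + Finsupp.single i 1) i (fun _ e => e.factorial) (by simp)
  have h2 := Finsupp.mul_prod_erase' s i (fun _ e => e.factorial) (by simp)
  rw [← h1, ← h2]
  have : (s + Finsupp.single i 1).erase i = s.erase i := by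
    ext j; by_cases h : j = i <;> simp [Finsupp.erase, h]
  rw [this]
  simp [Nat.factorial_succ]
  ring

/-- Fischer pairing. -/
noncomputable def fis : MvPolynomial σ R →ₗ[R] MvPolynomial σ R →ₗ[R] R :=
  (MvPolynomial.basisMonomials σ R).constr R (fun s => (mfac s : R) • MvPolynomial.lcoeff R s)

lemma fis_monomial (s : σ →₀ ℕ) (r : R) (G : MvPolynomial σ R) :
    fis (monomial s r) G = r * (mfac s * coeff s G) := by
  have : monomial s r = r • MvPolynomial.basisMonomials σ R s := by
    simp [MvPolynomial.smul_monomial]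
  rw [this, map_smul, fis, Module.Basis.constr_basis]
  simp

lemma fis_X_mul (i : σ) (Q G : MvPolynomial σ R) :
    fis (X i * Q) G = fis Q (pderiv i G) := by
  induction Q using MvPolynomial.induction_on' with
  | monomial s a =>
    rw [mul_comm, X, monomial_mul, mul_one, fis_monomial, fis_monomial, coeff_pderiv,
      mfac_add_single]
    push_cast; ring
  | add p q hp hq => rw [mul_add, map_add, map_add, LinearMap.add_apply, LinearMap.add_apply, hp, hq]

lemma fis_symm (Q G : MvPolynomial σ R) : fis Q G = fis G Q := by
  classical
  induction Q using MvPolynomial.induction_on' with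
  | monomial s a =>
    induction G using MvPolynomial.induction_on' with
    | monomial t b =>
      rw [fis_monomial, fis_monomial, coeff_monomial, coeff_monomial]
      by_cases h : t = s
      · subst h; simp; ring
      · simp [h, Ne.symm h]
    | add p q hp hq => rw [map_add, map_add, LinearMap.add_apply, hp, hq]
  | add p q hp hq => rw [map_add, map_add, LinearMap.add_apply, hp, hq]

lemma fis_X_mul' (i : σ) (Q G : MvPolynomial σ R) :
    fis Q (X i * G) = fis (pderiv i Q) G := by
  rw [fis_symm, fis_X_mul, fis_symm]

lemma fis_map {R' : Type*} [CommRing R'] (f : R →+* R') (Q G : MvPolynomial σ R) :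
    fis (map f Q) (map f G) = f (fis Q G) := by
  induction Q using MvPolynomial.induction_on' with
  | monomial s a => rw [map_monomial, fis_monomial, fis_monomial, coeff_map]; simp
  | add p q hp hq =>
    rw [map_add, map_add, map_add, LinearMap.add_apply, LinearMap.add_apply, hp, hq, map_add]

lemma fis_self_eq (Q : MvPolynomial σ ℚ) :
    fis Q Q = ∑ s ∈ Q.support, (mfac s : ℚ) * (coeff s Q) ^ 2 := by
  have h : ∀ G : MvPolynomial σ ℚ,
      fis Q G = ∑ s ∈ Q.support, coeff s Q * ((mfac s : ℚ) * coeff s G) := by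
    intro G
    conv_lhs => rw [Q.as_sum]
    rw [map_sum, LinearMap.sum_apply]
    exact Finset.sum_congr rfl fun s _ => fis_monomial _ _ _
  rw [h]
  exact Finset.sum_congr rfl fun s _ => by ring

lemma mfac_pos (s : σ →₀ ℕ) : 0 < mfac s :=
  Finset.prod_pos fun _ _ => Nat.factorial_pos _

lemma eq_zero_of_fis_self (Q : MvPolynomial σ ℚ) (h : fis Q Q = 0) : Q = 0 := by
  rw [fis_self_eq, Finset.sum_eq_zero_iff_of_nonneg (fun s _ => by positivity)] at h
  by_contra hne
  obtain ⟨s, hs⟩ := (MvPolynomial.support_nonempty.mpr hne)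
  have := h s hs
  have h1 := mfac_pos s
  rw [mem_support_iff] at hs
  have : (0 : ℚ) < (mfac s : ℚ) * coeff s Q ^ 2 := by positivity
  linarith

/-- orthogonal projection -/
lemma exists_proj (W : Submodule ℚ (MvPolynomial σ ℚ)) [FiniteDimensional ℚ W]
    (Q : MvPolynomial σ ℚ) : ∃ Q' ∈ W, ∀ w ∈ W, fis (Q - Q') w = 0 := by
  let B : W →ₗ[ℚ] Module.Dual ℚ W :=
    (LinearMap.lcomp ℚ ℚ W.subtype) ∘ₗ (fis : MvPolynomial σ ℚ →ₗ[ℚ] _) ∘ₗ W.subtype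
  have hB : ∀ a b : W, B a b = fis (a : MvPolynomial σ ℚ) (b : MvPolynomial σ ℚ) := fun _ _ => rfl
  have hinj : Function.Injective B := by
    rw [injective_iff_map_eq_zero]
    intro a ha
    have := hB a a
    rw [ha] at this
    exact Subtype.ext (eq_zero_of_fis_self _ this.symm)
  have hsurj := (LinearMap.injective_iff_surjective_of_finrank_eq_finrank
    (Subspace.dual_finrank_eq (K := ℚ) (V := W)).symm).mp hinj
  obtain ⟨a, ha⟩ := hsurj ((fis Q) ∘ₗ W.subtype)
  refine ⟨a, a.2, fun w hw => ?_⟩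
  have := hB a ⟨w, hw⟩
  rw [ha] at this
  rw [map_sub, LinearMap.sub_apply, sub_eq_zero]
  exact this

/-- a derivation applied coefficientwise (underlying function). -/
noncomputable def coefFun {A : Type*} [CommRing A] [Algebra A R] (D : Derivation A R R)
    (G : MvPolynomial σ R) : MvPolynomial σ R :=
  ∑ s ∈ G.support, monomial s (D (coeff s G))

lemma coeff_coefFun {A : Type*} [CommRing A] [Algebra A R] (D : Derivation A R R)
    (G : MvPolynomial σ R) (t : σ →₀ ℕ) : coeff t (coefFun D G) = D (coeff t G) := by
  classical
  rw [coefFun, coeff_sum]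
  simp only [coeff_monomial]
  rw [Finset.sum_ite_eq']
  split_ifs with h
  · rfl
  · rw [notMem_support_iff.mp h, map_zero]

/-- a derivation applied coefficientwise. -/
noncomputable def coefD {A : Type*} [CommRing A] [Algebra A R] (D : Derivation A R R) :
    Derivation A (MvPolynomial σ R) (MvPolynomial σ R) :=
  Derivation.mk'
    { toFun := coefFun D
      map_add' := by
        intro x y; ext t; simp [coeff_coefFun]
      map_smul' := by
        intro x y; ext t; simp [coeff_coefFun] } (by
      classical
      intro x y
      ext t
      simp only [LinearMap.coe_mk, AddHom.coe_mk, coeff_coefFun, smul_eq_mul, coeff_add]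
      rw [coeff_mul, coeff_mul, coeff_mul, map_sum, ← Finset.sum_add_distrib]
      have h2 : ∀ f : (σ →₀ ℕ) × (σ →₀ ℕ) → R,
          ∑ p ∈ Finset.HasAntidiagonal.antidiagonal t, f p = ∑ p ∈ Finset.HasAntidiagonal.antidiagonal t, f p.swap := by
        intro f
        exact (Finset.sum_equiv (Equiv.prodComm _ _) (by simp [add_comm]) (by simp)).symm
      rw [Finset.sum_add_distrib, h2 (fun p => coeff p.1 y * coeff p.2 (coefFun D x)),
        ← Finset.sum_add_distrib]
      refine Finset.sum_congr rfl fun p _ => ?_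
      simp [coeff_coefFun])

lemma coeff_coefD {A : Type*} [CommRing A] [Algebra A R] (D : Derivation A R R)
    (G : MvPolynomial σ R) (t : σ →₀ ℕ) : coeff t (coefD D G) = D (coeff t G) :=
  coeff_coefFun D G t

lemma coefD_C {A : Type*} [CommRing A] [Algebra A R] (D : Derivation A R R) (r : R) :
    coefD D (C r : MvPolynomial σ R) = C (D r) := by
  classical
  ext t
  rw [coeff_coefD, coeff_C, coeff_C]
  split_ifs <;> simp

lemma coefD_X {A : Type*} [CommRing A] [Algebra A R] (D : Derivation A R R) (i : σ) :
    coefD D (X i : MvPolynomial σ R) = 0 := by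
  classical
  ext t
  rw [coeff_coefD, coeff_X]
  split_ifs <;> simp

lemma coefD_map {A : Type*} [CommRing A] [Algebra A R] [Algebra ℚ R] (D : Derivation A R R)
    (Q : MvPolynomial σ ℚ) : coefD D (map (algebraMap ℚ R) Q) = 0 := by
  ext t
  rw [coeff_coefD, coeff_map, Algebra.algebraMap_eq_smul_one, map_rat_smul]
  simp

lemma D_fis {A : Type*} [CommRing A] [Algebra A R] (D : Derivation A R R)
    (Q G : MvPolynomial σ R) : D (fis Q G) = fis (coefD D Q) G + fis Q (coefD D G) := by
  classical
  induction Q using MvPolynomial.induction_on' with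
  | monomial s a =>
    have : coefD D (monomial s a) = monomial s (D a) := by
      ext t
      rw [coeff_coefD, coeff_monomial, coeff_monomial]
      split_ifs <;> simp
    rw [this, fis_monomial, fis_monomial, fis_monomial, coeff_coefD]
    simp
    ring
  | add p q hp hq =>
    simp only [map_add, LinearMap.add_apply, hp, hq]; ring

/-- shifted divided powers -/
noncomputable def ed {P : Type*} [CommRing P] [Algebra ℚ P] (θ : P) : ℕ → P
  | 0 => 0
  | d + 1 => ((d.factorial : ℚ)⁻¹) • θ ^ d

lemma D_ed {A P : Type*} [CommRing A] [CommRing P] [Algebra ℚ P] [Algebra A P]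
    (D : Derivation A P P) (θ : P) (d : ℕ) : D (ed θ (d + 1)) = ed θ d * D θ := by
  cases d with
  | zero => simp [ed]
  | succ d =>
    simp only [ed]
    rw [map_rat_smul, Derivation.leibniz_pow, smul_mul_assoc, Nat.factorial_succ]
    have : ((d + 1 : ℕ) • (θ ^ d * D θ)) = ((d + 1 : ℕ) : ℚ) • (θ ^ d * D θ) := by
      rw [Nat.cast_smul_eq_nsmul]
    simp only [Nat.add_sub_cancel, smul_eq_mul] at this ⊢
    rw [this, smul_smul]
    congr 1
    push_cast
    field_simp

end PartC

section PartD
open MvPolynomial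

variable {ι ν : Type*} [Fintype ι] [DecidableEq ι] [Fintype ν] [DecidableEq ν]
variable {R : Type*} [CommRing R]

/-- index type of the auxiliary variables -/
abbrev UV (ι ν : Type*) := (ι × ν) ⊕ (ι × ν)

/-- first kind of variables -/
noncomputable abbrev uu (R : Type*) [CommRing R] (c : ι) (a : ν) : MvPolynomial (UV ι ν) R :=
  X (Sum.inl (c, a))

/-- second kind of variables -/
noncomputable abbrev vv (R : Type*) [CommRing R] (c : ι) (a : ν) : MvPolynomial (UV ι ν) R :=
  X (Sum.inr (c, a))

/-- the bilinear form `∑ u Y v` -/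
noncomputable def theta (ι : Type*) [Fintype ι] (Y : ν → ν → R) : MvPolynomial (UV ι ν) R :=
  ∑ c : ι, ∑ a, ∑ b, C (Y a b) * (uu R c a * vv R c b)

/-- `u Y` -/
noncomputable def uY (Y : ν → ν → R) (c : ι) (b : ν) : MvPolynomial (UV ι ν) R :=
  ∑ a, C (Y a b) * uu R c a

/-- `Y v` -/
noncomputable def Yv (Y : ν → ν → R) (c : ι) (a : ν) : MvPolynomial (UV ι ν) R :=
  ∑ b, C (Y a b) * vv R c b

/-- the `2 × 2` minors -/
noncomputable def ww (R : Type*) [CommRing R] (T : Finset ι) (a b : ν) : MvPolynomial (UV ι ν) R :=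
  ∑ c ∈ T, (uu R c a * vv R c b - uu R c b * vv R c a)

lemma pderiv_inl_theta (Y : ν → ν → R) (c : ι) (a : ν) :
    pderiv (Sum.inl (c, a)) (theta ι Y) = Yv Y c a := by
  simp only [theta, map_sum, Derivation.leibniz, pderiv_C, pderiv_X, Pi.single_apply, Yv]
  simp [Prod.ext_iff, ite_and, Finset.sum_ite_eq]

lemma pderiv_inr_theta (Y : ν → ν → R) (c : ι) (b : ν) :
    pderiv (Sum.inr (c, b)) (theta ι Y) = uY Y c b := by
  simp only [theta, map_sum, Derivation.leibniz, pderiv_C, pderiv_X, Pi.single_apply, uY]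
  simp [Prod.ext_iff, ite_and, Finset.sum_ite_eq]

lemma pderiv_inr_Yv (Y : ν → ν → R) (c : ι) (a b : ν) :
    pderiv (Sum.inr (c, b)) (Yv Y c a : MvPolynomial (UV ι ν) R) = C (Y a b) := by
  simp only [Yv, map_sum, Derivation.leibniz, pderiv_C, pderiv_X, Pi.single_apply]
  simp [Prod.ext_iff]

variable {A : Type*} [CommRing A] [Algebra A R]

lemma coefD_theta (D : Derivation A R R) (Y : ν → ν → R) (a b : ν)
    (hD : ∀ i j, D (Y i j) = Y i b * Y a j - Y i a * Y b j) :
    coefD D (theta ι Y) = ∑ c : ι, (uY Y c b * Yv Y c a - uY Y c a * Yv Y c b) := by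
  simp only [theta, map_sum, Derivation.leibniz, coefD_C, coefD_X, smul_zero, zero_add, add_zero,
    hD, uY, Yv]
  refine Finset.sum_congr rfl fun c _ => ?_
  rw [Finset.sum_mul_sum, Finset.sum_mul_sum, ← Finset.sum_sub_distrib]
  refine Finset.sum_congr rfl fun i _ => ?_
  rw [← Finset.sum_sub_distrib]
  refine Finset.sum_congr rfl fun j _ => ?_
  simp only [map_sub, map_mul, smul_eq_mul]
  ring

variable [Algebra ℚ R]

lemma fis_uY_zero (Y : ν → ν → R) (c : ι) (b : ν) (Q G : MvPolynomial (UV ι ν) R)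
    (hQ : ∀ a, pderiv (Sum.inl (c, a)) Q = 0) : fis Q (uY Y c b * G) = 0 := by
  rw [uY, Finset.sum_mul, map_sum]
  refine Finset.sum_eq_zero fun a _ => ?_
  rw [mul_assoc, C_mul', map_smul, fis_X_mul', hQ, map_zero, LinearMap.zero_apply, smul_zero]

lemma fis_uv (Y : ν → ν → R) (c : ι) (a b : ν) (Q : MvPolynomial (UV ι ν) R) (d : ℕ) :
    fis (uu R c a * vv R c b * Q) (ed (theta ι Y) (d + 2)) =
      fis Q (ed (theta ι Y) d * (uY Y c b * Yv Y c a)) +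
        Y a b * fis Q (ed (theta ι Y) (d + 1)) := by
  have h1 : pderiv (Sum.inr (c, b)) (pderiv (Sum.inl (c, a)) (ed (theta ι Y) (d + 2))) =
      ed (theta ι Y) d * (uY Y c b * Yv Y c a) + Y a b • ed (theta ι Y) (d + 1) := by
    rw [D_ed, pderiv_inl_theta, Derivation.leibniz, D_ed, pderiv_inr_theta, pderiv_inr_Yv,
      smul_eq_mul, smul_eq_mul, smul_eq_C_mul]
    ring
  rw [mul_assoc, fis_X_mul, fis_X_mul, h1, (fis Q).map_add, (fis Q).map_smul, smul_eq_mul]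

/-- The derivative formula. -/
lemma deriv_formula (Y : ν → ν → R) (hY : ∀ a b, Y b a = - Y a b) (D : Derivation A R R) (a b : ν)
    (hD : ∀ i j, D (Y i j) = Y i b * Y a j - Y i a * Y b j) (T : Finset ι)
    (Q : MvPolynomial (UV ι ν) R) (hQD : coefD D Q = 0)
    (hQ : ∀ c, c ∉ T → ∀ i, pderiv (Sum.inl (c, i)) Q = 0) (d : ℕ) :
    fis (ww R T a b * Q) (ed (theta ι Y) (d + 2)) =
      D (fis Q (ed (theta ι Y) (d + 1))) +
        (2 * T.card : ℕ) * Y a b * fis Q (ed (theta ι Y) (d + 1)) := by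
  rw [D_fis, hQD, map_zero, LinearMap.zero_apply, zero_add, D_ed, coefD_theta D Y a b hD, ww,
    Finset.sum_mul, map_sum, LinearMap.sum_apply, Finset.mul_sum, map_sum]
  simp only [sub_mul, map_sub, LinearMap.sub_apply, fis_uv]
  rw [← Finset.sum_subset (Finset.subset_univ T)]
  · have : ((2 * T.card : ℕ) : R) * Y a b * fis Q (ed (theta ι Y) (d + 1)) =
        ∑ c ∈ T, 2 * Y a b * fis Q (ed (theta ι Y) (d + 1)) := by
      rw [Finset.sum_const, nsmul_eq_mul]; push_cast; ring
    rw [this, ← Finset.sum_add_distrib]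
    refine Finset.sum_congr rfl fun c _ => ?_
    rw [hY a b, mul_sub, map_sub]
    ring
  · intro c _ hc
    have h1 : ∀ i j, ed (theta ι Y) d * (uY Y c i * Yv Y c j) =
      uY Y c i * (ed (theta ι Y) d * Yv Y c j) := fun i j => by ring
    rw [mul_sub, map_sub, h1, h1, fis_uY_zero Y c _ Q _ (hQ c hc),
      fis_uY_zero Y c _ Q _ (hQ c hc), sub_zero]

/-- The Wick formula. -/
lemma wick (Y : ν → ν → R) (c : ι) (i j : ν) (Q : MvPolynomial (UV ι ν) R)
    (hQ : ∀ a, pderiv (Sum.inl (c, a)) Q = 0) (d t : ℕ) :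
    fis (uu R c i ^ (t + 1) * (vv R c j * Q)) (ed (theta ι Y) (d + 2)) =
      (t + 1 : ℕ) * Y i j * fis (uu R c i ^ t * Q) (ed (theta ι Y) (d + 1)) := by
  have h1 : uu R c i ^ (t + 1) * (vv R c j * Q) = vv R c j * (uu R c i ^ (t + 1) * Q) := by ring
  have h2 : ∀ a, ed (theta ι Y) (d + 1) * (C (Y a j) * uu R c a) =
      Y a j • (uu R c a * ed (theta ι Y) (d + 1)) := fun a => by rw [smul_eq_C_mul]; ring
  rw [h1, fis_X_mul, D_ed, pderiv_inr_theta, uY, Finset.mul_sum, map_sum,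
    Finset.sum_eq_single i]
  · rw [h2, LinearMap.map_smul, fis_X_mul', Derivation.leibniz, hQ, smul_zero,
      zero_add, Derivation.leibniz_pow, pderiv_X_self, Nat.add_sub_cancel, smul_eq_mul, smul_eq_mul,
      smul_eq_mul, mul_one, mul_smul_comm, mul_comm Q, map_nsmul, LinearMap.smul_apply,
      nsmul_eq_mul]
    ring
  · intro a _ ha
    rw [h2, LinearMap.map_smul, fis_X_mul', Derivation.leibniz, hQ, smul_zero,
      zero_add, Derivation.leibniz_pow, pderiv_X_of_ne]
    · simp
    · simp [Ne.symm ha]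
  · simp

lemma theta_eq (Y : ν → ν → R) (hY : ∀ a b, Y b a = - Y a b) :
    (2 : R) • theta ι Y = ∑ a, ∑ b, Y a b • ww R Finset.univ a b := by
  have h1 : theta ι Y = ∑ a, ∑ b, ∑ c : ι, C (Y a b) * (uu R c a * vv R c b) := by
    rw [theta, Finset.sum_comm]
    exact Finset.sum_congr rfl fun a _ => Finset.sum_comm
  have h2 : theta ι Y = ∑ a, ∑ b, ∑ c : ι, C (Y b a) * (uu R c b * vv R c a) := by
    rw [h1, Finset.sum_comm]
  rw [two_smul]
  nth_rewrite 1 [h1]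
  rw [h2, ← Finset.sum_add_distrib]
  refine Finset.sum_congr rfl fun a _ => ?_
  rw [← Finset.sum_add_distrib]
  refine Finset.sum_congr rfl fun b _ => ?_
  rw [← Finset.sum_add_distrib, ww, Finset.smul_sum]
  refine Finset.sum_congr rfl fun c _ => ?_
  rw [hY a b, smul_eq_C_mul, C_neg]
  ring

/-- span of the minors -/
noncomputable def wspan (ι ν : Type*) [Fintype ι] : Submodule ℚ (MvPolynomial (UV ι ν) ℚ) :=
  Submodule.span ℚ (Set.range fun p : ν × ν => ww ℚ (Finset.univ : Finset ι) p.1 p.2)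

lemma map_ww (T : Finset ι) (a b : ν) : map (algebraMap ℚ R) (ww ℚ T a b) = ww R T a b := by
  simp [ww]

lemma theta_mem (Y : ν → ν → R) (hY : ∀ a b, Y b a = - Y a b) :
    theta ι Y ∈ Submodule.span R (Set.range fun p : ν × ν => ww R (Finset.univ : Finset ι) p.1 p.2) := by
  have h2 : theta ι Y = (algebraMap ℚ R (1/2)) • (2 : R) • theta ι Y := by
    rw [smul_smul]
    have : (algebraMap ℚ R (1/2)) * 2 = 1 := by
      rw [← map_ofNat (algebraMap ℚ R) 2, ← map_mul]; norm_num
    rw [this, one_smul]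
  rw [h2, theta_eq Y hY]
  refine Submodule.smul_mem _ _ (Submodule.sum_mem _ fun a _ => Submodule.sum_mem _ fun b _ =>
    Submodule.smul_mem _ _ (Submodule.subset_span ⟨(a, b), rfl⟩))

lemma fis_theta_pow_zero (Y : ν → ν → R) (hY : ∀ a b, Y b a = - Y a b) (d : ℕ)
    (Q : MvPolynomial (UV ι ν) ℚ) (hQ : ∀ w ∈ wspan ι ν ^ d, fis Q w = 0) :
    fis (map (algebraMap ℚ R) Q) (theta ι Y ^ d) = 0 := by
  have h1 := Submodule.pow_mem_pow _ (theta_mem (ι := ι) Y hY) d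
  rw [Submodule.span_pow] at h1
  refine (Submodule.span_le (p := LinearMap.ker (fis (map (algebraMap ℚ R) Q)))).mpr ?_ h1
  intro G hG
  have h3 : (Set.range fun p : ν × ν => ww R (Finset.univ : Finset ι) p.1 p.2) =
      (map (algebraMap ℚ R)) '' (Set.range fun p : ν × ν => ww ℚ (Finset.univ : Finset ι) p.1 p.2) := by
    rw [← Set.range_comp]
    congr 1
    funext p
    exact (map_ww _ _ _).symm
  rw [h3, ← Set.image_pow] at hG
  obtain ⟨w, hw, rfl⟩ := hG
  rw [SetLike.mem_coe, LinearMap.mem_ker, fis_map, hQ, map_zero]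
  rw [wspan, Submodule.span_pow]
  exact Submodule.subset_span hw

lemma exists_proj_theta (Y : ν → ν → R) (hY : ∀ a b, Y b a = - Y a b) (d : ℕ)
    (Q : MvPolynomial (UV ι ν) ℚ) : ∃ Q' ∈ wspan ι ν ^ d,
      fis (map (algebraMap ℚ R) Q) (ed (theta ι Y) (d + 1)) =
        fis (map (algebraMap ℚ R) Q') (ed (theta ι Y) (d + 1)) := by
  have hfg : (wspan ι ν).FG := Submodule.fg_span (Set.finite_range _)
  haveI : FiniteDimensional ℚ ↥(wspan ι ν ^ d) :=
    Module.Finite.iff_fg.mpr (hfg.pow d)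
  obtain ⟨Q', hQ', h⟩ := exists_proj (wspan ι ν ^ d) Q
  refine ⟨Q', hQ', ?_⟩
  have := fis_theta_pow_zero Y hY d (Q - Q') h
  rw [map_sub, map_sub, LinearMap.sub_apply, sub_eq_zero] at this
  simp only [ed]
  rw [map_rat_smul, map_rat_smul, this]
end PartD

end Helpers

end SkewLC

namespace SkewLC

section PartB
open MvPolynomial

/-- The derivation `∂ / ∂ x_{c,b}` for an arbitrary ordered pair. -/
def dE (n : ℕ) (c b : Fin n) : Derivation ℂ (PS n) (PS n) :=
  if h : c < b then pderiv ⟨(c, b), h⟩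
  else if h' : b < c then - pderiv ⟨(b, c), h'⟩
  else 0

lemma genEntry_skew (n : ℕ) (i j : Fin n) : genEntry n j i = - genEntry n i j := by
  unfold genEntry
  rcases lt_trichotomy i j with h | h | h
  · simp [h, h.not_gt]
  · simp [h]
  · simp [h, h.not_gt]

lemma dE_skew (n : ℕ) (i j : Fin n) : dE n j i = - dE n i j := by
  unfold dE
  rcases lt_trichotomy i j with h | h | h
  · simp [h, h.not_gt]
  · simp [h]
  · simp [h, h.not_gt]

lemma dE_X (n : ℕ) (c b i j : Fin n) (hij : i < j) :
    dE n c b (X ⟨(i, j), hij⟩) =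
      (if i = c ∧ j = b then 1 else 0) - (if i = b ∧ j = c then 1 else 0) := by
  unfold dE
  rcases lt_trichotomy c b with h | h | h
  · have h1 : ¬ (i = b ∧ j = c) := by rintro ⟨rfl, rfl⟩; exact absurd hij h.not_gt
    rw [dif_pos h, pderiv_X, Pi.single_apply, if_neg h1, sub_zero]
    simp [Subtype.ext_iff, Prod.ext_iff]
  · subst h
    simp
  · have h1 : ¬ (i = c ∧ j = b) := by rintro ⟨rfl, rfl⟩; exact absurd hij h.not_gt
    rw [dif_neg h.not_gt, dif_pos h, Derivation.neg_apply, pderiv_X, Pi.single_apply, if_neg h1,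
      zero_sub]
    simp [Subtype.ext_iff, Prod.ext_iff]

lemma dE_genEntry (n : ℕ) (c b i j : Fin n) :
    dE n c b (genEntry n i j) =
      (if i = c ∧ j = b then 1 else 0) - (if i = b ∧ j = c then 1 else 0) := by
  rcases lt_trichotomy i j with h | h | h
  · rw [genEntry, dif_pos h, dE_X]
  · subst h
    simp [genEntry, and_comm]
  · rw [genEntry, dif_neg h.not_gt, dif_pos h, map_neg, dE_X]
    simp [and_comm]

/-- the polarization derivation -/
def polD (n : ℕ) (a c : Fin n) : Derivation ℂ (PS n) (PS n) :=
  ∑ b, genEntry n a b • dE n c b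

lemma polD_apply (n : ℕ) (a c : Fin n) (F : PS n) :
    polD n a c F = ∑ b, genEntry n a b * dE n c b F := by
  rw [polD, ← Derivation.coeFnAddMonoidHom_apply, map_sum, Finset.sum_apply]
  rfl

lemma polD_genEntry (n : ℕ) (a c i j : Fin n) : polD n a c (genEntry n i j) =
    (if i = c then genEntry n a j else 0) + (if j = c then genEntry n i a else 0) := by
  rw [polD_apply]
  simp only [dE_genEntry, mul_sub, Finset.sum_sub_distrib]
  simp only [mul_ite, mul_one, mul_zero, ite_and]
  rw [genEntry_skew n a i]
  by_cases h : i = c <;> by_cases h' : j = c <;> simp [h, h', sub_eq_add_neg]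

lemma leibniz_finprod {P κ : Type*} [CommRing P] [Algebra ℂ P] [DecidableEq κ]
    (D : Derivation ℂ P P) (s : Finset κ) (f : κ → P) :
    D (∏ i ∈ s, f i) = ∑ i ∈ s, (∏ j ∈ s.erase i, f j) * D (f i) := by
  induction s using Finset.induction_on with
  | empty => simp
  | insert i s hi ih =>
    rw [Finset.prod_insert hi, Derivation.leibniz, ih, Finset.sum_insert hi,
      Finset.erase_insert hi, smul_eq_mul, smul_eq_mul, add_comm, Finset.mul_sum]
    congr 1
    refine Finset.sum_congr rfl fun j hj => ?_
    have hij : i ≠ j := fun h => hi (h ▸ hj)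
    rw [Finset.erase_insert_of_ne hij, Finset.prod_insert (by simp [hi]), mul_assoc]

/-- first index of a pair -/
abbrev ev {m : ℕ} (i : Fin m) : Fin (2 * m) := ⟨2 * i.1, by have := i.isLt; omega⟩
/-- second index of a pair -/
abbrev od {m : ℕ} (i : Fin m) : Fin (2 * m) := ⟨2 * i.1 + 1, by have := i.isLt; omega⟩

lemma polD_prod (m : ℕ) (a c : Fin (2 * m)) (σ : Equiv.Perm (Fin (2 * m))) :
    polD (2 * m) a c (∏ i : Fin m, genEntry (2 * m) (σ (ev i)) (σ (od i))) =
      ∏ i : Fin m, genEntry (2 * m) (Function.update id c a (σ (ev i)))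
        (Function.update id c a (σ (od i))) := by
  rw [leibniz_finprod]
  obtain ⟨q, hq⟩ := σ.surjective c
  let i0 : Fin m := ⟨q.1 / 2, by have := q.isLt; omega⟩
  have hne : ∀ i, i ≠ i0 → σ (ev i) ≠ c ∧ σ (od i) ≠ c := by
    intro i hi
    constructor
    · intro h
      have := σ.injective (h.trans hq.symm)
      apply hi; ext; simp only [i0, ← this]; omega
    · intro h
      have := σ.injective (h.trans hq.symm)
      apply hi; ext; simp only [i0, ← this]; omega
  rw [Finset.sum_eq_single i0]
  · rw [← Finset.prod_erase_mul _ _ (Finset.mem_univ i0)]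
    congr 1
    · refine Finset.prod_congr rfl fun j hj => ?_
      have h := hne j (Finset.ne_of_mem_erase hj)
      rw [Function.update_of_ne h.1, Function.update_of_ne h.2]; rfl
    · rw [polD_genEntry]
      have h2 : q = ev i0 ∨ q = od i0 := by
        rcases Nat.mod_two_eq_zero_or_one q.1 with h | h
        · left; ext; simp only [i0]; omega
        · right; ext; simp only [i0]; omega
      have h3 : ev i0 ≠ od i0 := by intro h; have := congrArg Fin.val h; simp at this
      rcases h2 with h | h
      · have h4 : σ (od i0) ≠ c := by
          rw [← hq]; intro h5; exact h3 ((σ.injective h5).trans h).symm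
        have h5 : σ (ev i0) = c := by rw [← h, hq]
        rw [if_pos h5, if_neg h4, h5, Function.update_self, Function.update_of_ne h4, add_zero]; rfl
      · have h4 : σ (ev i0) ≠ c := by
          rw [← hq]; intro h5; exact h3 ((σ.injective h5).trans h)
        have h5 : σ (od i0) = c := by rw [← h, hq]
        rw [if_neg h4, if_pos h5, h5, Function.update_self, Function.update_of_ne h4, zero_add]; rfl
  · intro i _ hi
    rw [polD_genEntry, if_neg (hne i hi).1, if_neg (hne i hi).2, add_zero, mul_zero]
  · simp

lemma pfaffian_eq (m : ℕ) : pfaffian (2 * m) = (((2 ^ m * m.factorial : ℕ) : ℂ))⁻¹ •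
      ∑ σ : Equiv.Perm (Fin (2 * m)), (Equiv.Perm.sign σ : ℤ) •
          ∏ i : Fin m, genEntry (2 * m) (σ (ev i)) (σ (od i)) := by
  have h : 2 * m / 2 = m := by omega
  rw [pfaffian, h, pfBlock, dif_pos le_rfl]
  rfl

lemma polD_pfaffian (m : ℕ) (a c : Fin (2 * m)) :
    polD (2 * m) a c (pfaffian (2 * m)) = if a = c then pfaffian (2 * m) else 0 := by
  rw [pfaffian_eq, Derivation.map_smul, map_sum]
  simp only [map_zsmul, polD_prod]
  split_ifs with h
  · subst h
    have hu : Function.update (id : Fin (2 * m) → Fin (2 * m)) a a = id := Function.update_eq_self a id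
    simp only [hu, id]
  · have : ∑ σ : Equiv.Perm (Fin (2 * m)), (Equiv.Perm.sign σ : ℤ) •
        ∏ i : Fin m, genEntry (2 * m) (Function.update id c a (σ (ev i)))
          (Function.update id c a (σ (od i))) = 0 := by
      refine Finset.sum_involution (fun σ _ => Equiv.swap a c * σ) ?_ ?_ ?_ ?_
      · intro σ _
        have hf : ∀ x, Function.update (id : Fin (2 * m) → Fin (2 * m)) c a (Equiv.swap a c x) =
            Function.update id c a x := by
          intro x
          by_cases h1 : x = a
          · subst h1; rw [Equiv.swap_apply_left, Function.update_self, Function.update_of_ne h]; rfl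
          · by_cases h2 : x = c
            · subst h2; rw [Equiv.swap_apply_right, Function.update_self, Function.update_of_ne h]; rfl
            · rw [Equiv.swap_apply_of_ne_of_ne h1 h2]
        simp only [Equiv.Perm.mul_apply, hf, Equiv.Perm.sign_mul, Equiv.Perm.sign_swap h]
        simp
      · intro σ _ _ h1
        have : Equiv.swap a c = 1 := by simpa using h1
        rw [Equiv.swap_eq_one_iff] at this
        exact h this
      · intro σ _; exact Finset.mem_univ _
      · intro σ _; rw [← mul_assoc, Equiv.swap_mul_self, one_mul]
    rw [this, smul_zero]

lemma pf_identity (m : ℕ) (a c : Fin (2 * m)) :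
    ∑ b, genEntry (2 * m) a b * dE (2 * m) c b (pfaffian (2 * m)) =
      if a = c then pfaffian (2 * m) else 0 := by
  rw [← polD_apply, polD_pfaffian]

end PartB

section PartE
open MvPolynomial

variable {ι ν : Type*} [Fintype ι] [DecidableEq ι] [Fintype ν] [DecidableEq ν]
variable {P R : Type*} [CommRing P] [CommRing R] [Algebra P R] [Algebra ℚ P] [Algebra ℚ R]
  [IsScalarTower ℚ P R]

/-- the functional `Λ_d` -/
def lam (ι : Type*) [Fintype ι] (Y : ν → ν → R) (d : ℕ) : MvPolynomial (UV ι ν) ℚ →ₗ[ℚ] R where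
  toFun Q := fis (map (algebraMap ℚ R) Q) (ed (theta ι Y) (d + 1))
  map_add' x y := by rw [map_add, map_add, LinearMap.add_apply]
  map_smul' q x := by
    rw [smul_eq_C_mul, map_mul, map_C, C_mul', map_smul, LinearMap.smul_apply, RingHom.id_apply,
      smul_eq_mul, ← Algebra.smul_def]

lemma lam_apply (Y : ν → ν → R) (d : ℕ) (Q : MvPolynomial (UV ι ν) ℚ) :
    lam ι Y d Q = fis (map (algebraMap ℚ R) Q) (ed (theta ι Y) (d + 1)) := rfl

lemma lam_zero_C (Y : ν → ν → R) (q : ℚ) : lam ι Y 0 (C q) = algebraMap ℚ R q := by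
  rw [lam_apply, map_C, ← monomial_zero', fis_monomial]
  simp [ed, mfac]

lemma map_mul_mem_rat (M : Submodule P R) (q : ℚ) {x : R} (hx : x ∈ M) : q • x ∈ M := by
  have : q • x = (algebraMap ℚ P q) • x := (algebraMap_smul P q x).symm
  rw [this]
  exact M.smul_mem _ hx

variable {A : Type*} [CommRing A] [Algebra A R]

lemma deriv_pow (D : Derivation A R R) (p y : R) (h : D p = y * p) (j : ℕ) :
    D (p ^ j) = j * y * p ^ j := by
  induction j with
  | zero => simp
  | succ j ih =>
    rw [pow_succ, Derivation.leibniz, ih, h, smul_eq_mul, smul_eq_mul]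
    push_cast; ring

lemma deriv_lam (Y : ν → ν → R) (hY : ∀ a b, Y b a = - Y a b) (D : Derivation A R R) (a b : ν)
    (hD : ∀ i j, D (Y i j) = Y i b * Y a j - Y i a * Y b j) (p : R) (hp : D p = Y a b * p)
    (T : Finset ι) (Q : MvPolynomial (UV ι ν) ℚ)
    (hQ : ∀ c, c ∉ T → ∀ i, pderiv (Sum.inl (c, i)) Q = 0) (d : ℕ) :
    D (p ^ (2 * T.card) * lam ι Y d Q) = p ^ (2 * T.card) * lam ι Y (d + 1) (ww ℚ T a b * Q) := by
  have h := deriv_formula Y hY D a b hD T (map (algebraMap ℚ R) Q) (coefD_map D Q)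
    (fun c hc i => by rw [pderiv_map, hQ c hc i, map_zero]) d
  rw [lam_apply, lam_apply, RingHom.map_mul, map_ww, h, Derivation.leibniz, deriv_pow D p _ hp,
    smul_eq_mul, smul_eq_mul]
  ring

lemma lower_aux (Y : ν → ν → R) (hY : ∀ a b, Y b a = - Y a b) (D : ν → ν → Derivation A R R)
    (hD : ∀ a b i j, D a b (Y i j) = Y i b * Y a j - Y i a * Y b j) (p : R)
    (hp : ∀ a b, D a b p = Y a b * p) (M : Submodule P R)
    (hM : ∀ a b, ∀ x ∈ M, D a b x ∈ M) (hpM : p ^ (2 * Fintype.card ι) ∈ M)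
    (d : ℕ) (Q : MvPolynomial (UV ι ν) ℚ) (hQ : Q ∈ wspan ι ν ^ d) :
    p ^ (2 * Fintype.card ι) * lam ι Y d Q ∈ M := by
  let Mq : Submodule ℚ R :=
    { carrier := M, add_mem' := M.add_mem, zero_mem' := M.zero_mem,
      smul_mem' := fun q x hx => map_mul_mem_rat M q hx }
  let Φ : ℕ → MvPolynomial (UV ι ν) ℚ →ₗ[ℚ] R := fun d =>
    LinearMap.mulLeft ℚ (p ^ (2 * Fintype.card ι)) ∘ₗ lam ι Y d
  have hΦ : ∀ d Q, Φ d Q = p ^ (2 * Fintype.card ι) * lam ι Y d Q := fun _ _ => rfl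
  have hMq : ∀ x, x ∈ Mq ↔ x ∈ M := fun _ => Iff.rfl
  suffices h : ∀ d, wspan ι ν ^ d ≤ Mq.comap (Φ d) from h d hQ
  clear d Q hQ
  intro d
  induction d with
  | zero =>
    intro Q hQ
    rw [pow_zero, Submodule.mem_one] at hQ
    obtain ⟨q, rfl⟩ := hQ
    rw [Submodule.mem_comap, hΦ, algebraMap_eq, lam_zero_C, mul_comm, ← Algebra.smul_def]
    exact map_mul_mem_rat M q hpM
  | succ d ih =>
    rw [pow_succ', Submodule.mul_le]
    intro w hw Q hQ
    have : wspan ι ν ≤ (Mq.comap (Φ (d + 1))).comap (LinearMap.mulRight ℚ Q) := by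
      rw [wspan, Submodule.span_le]
      rintro _ ⟨⟨a, b⟩, rfl⟩
      have h1 := deriv_lam Y hY (D a b) a b (hD a b) p (hp a b) Finset.univ Q
        (fun c hc => absurd (Finset.mem_univ c) hc) d
      rw [Finset.card_univ] at h1
      rw [SetLike.mem_coe, Submodule.mem_comap, Submodule.mem_comap, LinearMap.mulRight_apply, hΦ,
        ← h1, hMq]
      refine hM a b _ ?_
      rw [← hΦ, ← hMq]
      exact ih hQ
    exact this hw

lemma lower (Y : ν → ν → R) (hY : ∀ a b, Y b a = - Y a b) (D : ν → ν → Derivation A R R)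
    (hD : ∀ a b i j, D a b (Y i j) = Y i b * Y a j - Y i a * Y b j) (p : R)
    (hp : ∀ a b, D a b p = Y a b * p) (M : Submodule P R)
    (hM : ∀ a b, ∀ x ∈ M, D a b x ∈ M) (hpM : p ^ (2 * Fintype.card ι) ∈ M)
    (d : ℕ) (Q : MvPolynomial (UV ι ν) ℚ) :
    p ^ (2 * Fintype.card ι) * lam ι Y d Q ∈ M := by
  obtain ⟨Q', hQ', h⟩ := exists_proj_theta Y hY d Q
  rw [lam_apply, h, ← lam_apply]
  exact lower_aux Y hY D hD p hp M hM hpM d Q' hQ'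

/-- The intermediate module. -/
def nMod (P : Type*) [CommRing P] [Algebra P R] (c0 : ι) (i0 : ν) (Y : ν → ν → R) (p : R) (k : ℕ) :
    Submodule P R :=
  Submodule.span P {x | ∃ (d t : ℕ) (Q : MvPolynomial (UV ι ν) ℚ),
    (∀ a, pderiv (Sum.inl (c0, a)) Q = 0) ∧
      x = p ^ (2 * k) * lam ι Y d (uu ℚ c0 i0 ^ t * Q)}

/-- The upper module. -/
def uMod (P : Type*) [CommRing P] [Algebra P R] (c0 : ι) (Y : ν → ν → R) (p : R) (k : ℕ) :
    Submodule P R :=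
  Submodule.span P {x | ∃ (d : ℕ) (Q : MvPolynomial (UV ι ν) ℚ),
    (∀ a, pderiv (Sum.inl (c0, a)) Q = 0) ∧ x = p ^ (2 * k) * lam ι Y d Q}

lemma uMod_le_nMod (c0 : ι) (i0 : ν) (Y : ν → ν → R) (p : R) (k : ℕ) :
    uMod P c0 Y p k ≤ nMod P c0 i0 Y p k := by
  refine Submodule.span_mono ?_
  rintro x ⟨d, Q, hQ, rfl⟩
  exact ⟨d, 0, Q, hQ, by rw [pow_zero, one_mul]⟩

lemma self_mem_uMod (c0 : ι) (Y : ν → ν → R) (p : R) (k : ℕ) :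
    p ^ (2 * k) ∈ uMod P c0 Y p k := by
  refine Submodule.subset_span ⟨0, C 1, by simp, ?_⟩
  rw [lam_zero_C, map_one, mul_one]

lemma uMod_stable (c0 : ι) (Y : ν → ν → R) (hY : ∀ a b, Y b a = - Y a b) (D : Derivation A R R)
    (a b : ν) (hD : ∀ i j, D (Y i j) = Y i b * Y a j - Y i a * Y b j) (p : R)
    (hp : D p = Y a b * p) (hDP : ∀ s : P, ∃ s' : P, D (algebraMap P R s) = algebraMap P R s')
    (k : ℕ) (hk : Fintype.card ι = k + 1) (x : R) (hx : x ∈ uMod P c0 Y p k) :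
    D x ∈ uMod P c0 Y p k := by
  induction hx using Submodule.span_induction with
  | mem x h =>
    obtain ⟨d, Q, hQ, rfl⟩ := h
    have hc : (Finset.univ.erase c0).card = k := by
      rw [Finset.card_erase_of_mem (Finset.mem_univ _), Finset.card_univ, hk, Nat.add_sub_cancel]
    have h1 := deriv_lam Y hY D a b hD p hp (Finset.univ.erase c0) Q (by
      intro c hc
      have : c = c0 := by simpa using hc
      subst this
      exact hQ) d
    rw [hc] at h1
    rw [h1]
    refine Submodule.subset_span ⟨d + 1, _, ?_, rfl⟩
    intro i
    rw [Derivation.leibniz, hQ, smul_zero, zero_add]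
    have : pderiv (Sum.inl (c0, i)) (ww ℚ (Finset.univ.erase c0) a b) = 0 := by
      rw [ww, map_sum]
      refine Finset.sum_eq_zero fun c hc => ?_
      have hne : c ≠ c0 := Finset.ne_of_mem_erase hc
      simp [Derivation.leibniz, pderiv_X, Pi.single_apply, hne]
    rw [this, smul_zero]
  | zero => rw [map_zero]; exact Submodule.zero_mem _
  | add x y _ _ hx hy => rw [map_add]; exact Submodule.add_mem _ hx hy
  | smul s x h hx =>
    obtain ⟨s', hs⟩ := hDP s
    rw [Algebra.smul_def, Derivation.leibniz, hs, smul_eq_mul, smul_eq_mul, mul_comm x,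
      ← Algebra.smul_def, ← Algebra.smul_def]
    exact Submodule.add_mem _ (Submodule.smul_mem _ _ hx) (Submodule.smul_mem _ _ h)

lemma nMod_stable (c0 : ι) (i0 : ν) (Y : ν → ν → R) (p : R) (k : ℕ) (j : ν) (x : R)
    (hx : x ∈ nMod P c0 i0 Y p k) : Y i0 j * x ∈ nMod P c0 i0 Y p k := by
  induction hx using Submodule.span_induction with
  | mem x h =>
    obtain ⟨d, t, Q, hQ, rfl⟩ := h
    have h1 := wick Y c0 i0 j (map (algebraMap ℚ R) Q)
      (fun a => by rw [pderiv_map, hQ, map_zero]) d t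
    have h2 : lam ι Y (d + 1) (uu ℚ c0 i0 ^ (t + 1) * (vv ℚ c0 j * Q)) =
        (t + 1 : ℕ) * Y i0 j * lam ι Y d (uu ℚ c0 i0 ^ t * Q) := by
      rw [lam_apply, lam_apply]
      simpa only [map_mul, map_pow, map_X] using h1
    have h3 : Y i0 j * (p ^ (2 * k) * lam ι Y d (uu ℚ c0 i0 ^ t * Q)) =
        ((t + 1 : ℕ) : ℚ)⁻¹ • (p ^ (2 * k) *
          lam ι Y (d + 1) (uu ℚ c0 i0 ^ (t + 1) * (vv ℚ c0 j * Q))) := by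
      have h4 : algebraMap ℚ R ((t + 1 : ℕ) : ℚ)⁻¹ * ((t + 1 : ℕ) : R) = 1 := by
        rw [← map_natCast (algebraMap ℚ R), ← map_mul, inv_mul_cancel₀, map_one]
        positivity
      rw [h2, Algebra.smul_def]
      calc _ = 1 * (Y i0 j * (p ^ (2 * k) * lam ι Y d (uu ℚ c0 i0 ^ t * Q))) := (one_mul _).symm
        _ = _ := by rw [← h4]; ring
    rw [h3]
    refine map_mul_mem_rat _ _ (Submodule.subset_span ⟨d + 1, t + 1, _, ?_, rfl⟩)
    intro a
    rw [Derivation.leibniz, hQ, smul_zero, zero_add, pderiv_X_of_ne (by simp), smul_zero]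
  | zero => rw [mul_zero]; exact Submodule.zero_mem _
  | add x y _ _ hx hy => rw [mul_add]; exact Submodule.add_mem _ hx hy
  | smul s x h hx => rw [mul_smul_comm]; exact Submodule.smul_mem _ _ hx

lemma nMod_le (c0 : ι) (i0 : ν) (Y : ν → ν → R) (hY : ∀ a b, Y b a = - Y a b)
    (D : ν → ν → Derivation A R R)
    (hD : ∀ a b i j, D a b (Y i j) = Y i b * Y a j - Y i a * Y b j) (p : R)
    (hp : ∀ a b, D a b p = Y a b * p) (f : P) (hf : algebraMap P R f * p = 1)
    (k : ℕ) (hk : Fintype.card ι = k + 1) (M : Submodule P R)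
    (hM : ∀ a b, ∀ x ∈ M, D a b x ∈ M) (hpM : p ^ (2 * k + 2) ∈ M) :
    nMod P c0 i0 Y p k ≤ M := by
  rw [nMod, Submodule.span_le]
  rintro x ⟨d, t, Q, _, rfl⟩
  have h1 := lower (ι := ι) Y hY D hD p hp M hM (by rw [hk]; exact hpM) d (uu ℚ c0 i0 ^ t * Q)
  have h2 : p ^ (2 * k) * lam ι Y d (uu ℚ c0 i0 ^ t * Q) =
      (f ^ 2) • (p ^ (2 * Fintype.card ι) * lam ι Y d (uu ℚ c0 i0 ^ t * Q)) := by
    rw [hk, Algebra.smul_def, map_pow]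
    calc _ = (algebraMap P R f * p) ^ 2 * (p ^ (2 * k) * lam ι Y d (uu ℚ c0 i0 ^ t * Q)) := by
          rw [hf]; ring
      _ = _ := by ring
  rw [h2]
  exact M.smul_mem _ h1

end PartE

section PartF
open MvPolynomial

/-- The derivation of `S_Pf` attached to an ordered pair. -/
def dR (n : ℕ) (δ : SkewIdx n → Derivation ℂ (SPf n) (SPf n)) (c b : Fin n) :
    Derivation ℂ (SPf n) (SPf n) :=
  if h : c < b then δ ⟨(c, b), h⟩
  else if h' : b < c then - δ ⟨(b, c), h'⟩
  else 0

lemma dR_algebraMap (n : ℕ) (δ : SkewIdx n → Derivation ℂ (SPf n) (SPf n))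
    (hδ : IsDerivExtension n δ) (c b : Fin n) (f : PS n) :
    dR n δ c b (algebraMap (PS n) (SPf n) f) = algebraMap (PS n) (SPf n) (dE n c b f) := by
  unfold dR dE
  split_ifs
  · exact hδ _ _
  · rw [Derivation.neg_apply, Derivation.neg_apply, hδ, map_neg]
  · rw [Derivation.zero_apply, Derivation.zero_apply, map_zero]

lemma dR_mem (n : ℕ) (δ : SkewIdx n → Derivation ℂ (SPf n) (SPf n))
    (M : Submodule (PS n) (SPf n)) (hM : DStable n δ M) (c b : Fin n) (x : SPf n) (hx : x ∈ M) :
    dR n δ c b x ∈ M := by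
  unfold dR
  split_ifs
  · exact hM _ _ hx
  · rw [Derivation.neg_apply]; exact M.neg_mem (hM _ _ hx)
  · rw [Derivation.zero_apply]; exact M.zero_mem

lemma pf_mul_inv (n : ℕ) : algebraMap (PS n) (SPf n) (pfaffian n) * pfInv n = 1 :=
  IsLocalization.Away.mul_invSelf _

/-- The inverse of the generic matrix. -/
def yInv (n : ℕ) (b c : Fin n) : SPf n :=
  algebraMap (PS n) (SPf n) (dE n c b (pfaffian n)) * pfInv n

lemma yInv_skew (n : ℕ) (a b : Fin n) : yInv n b a = - yInv n a b := by
  unfold yInv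
  rw [dE_skew n b a, Derivation.neg_apply, map_neg, neg_mul]

lemma dR_pfInv (n : ℕ) (δ : SkewIdx n → Derivation ℂ (SPf n) (SPf n))
    (hδ : IsDerivExtension n δ) (a b : Fin n) :
    dR n δ a b (pfInv n) = yInv n a b * pfInv n := by
  have h := congrArg (dR n δ a b) (pf_mul_inv n)
  rw [Derivation.leibniz, Derivation.map_one_eq_zero, dR_algebraMap n δ hδ, smul_eq_mul,
    smul_eq_mul] at h
  rw [yInv_skew n b a, yInv]
  linear_combination (pfInv n) * h - dR n δ a b (pfInv n) * pf_mul_inv n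

lemma gen_mul_yInv (m : ℕ) (a c : Fin (2 * m)) :
    ∑ b, algebraMap (PS (2 * m)) (SPf (2 * m)) (genEntry (2 * m) a b) * yInv (2 * m) b c =
      if a = c then 1 else 0 := by
  have h := congrArg (algebraMap (PS (2 * m)) (SPf (2 * m))) (pf_identity m a c)
  rw [map_sum] at h
  simp only [map_mul] at h
  unfold yInv
  simp only [← mul_assoc]
  rw [← Finset.sum_mul, h]
  split_ifs
  · exact pf_mul_inv _
  · simp

lemma yInv_mul_gen (m : ℕ) (a c : Fin (2 * m)) :
    ∑ b, yInv (2 * m) a b * algebraMap (PS (2 * m)) (SPf (2 * m)) (genEntry (2 * m) b c) =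
      if a = c then 1 else 0 := by
  let MX : Matrix (Fin (2 * m)) (Fin (2 * m)) (SPf (2 * m)) :=
    Matrix.of fun a b => algebraMap (PS (2 * m)) (SPf (2 * m)) (genEntry (2 * m) a b)
  let MY : Matrix (Fin (2 * m)) (Fin (2 * m)) (SPf (2 * m)) := Matrix.of (yInv (2 * m))
  have h : MX * MY = 1 := by
    ext a c
    rw [Matrix.mul_apply, Matrix.one_apply]
    exact gen_mul_yInv m a c
  have h' : MY * MX = 1 := mul_eq_one_comm.mp h
  have h2 := congrFun (congrFun h' a) c
  rw [Matrix.mul_apply, Matrix.one_apply] at h2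
  exact h2

lemma dR_yInv (m : ℕ) (δ : SkewIdx (2 * m) → Derivation ℂ (SPf (2 * m)) (SPf (2 * m)))
    (hδ : IsDerivExtension (2 * m) δ) (a b i j : Fin (2 * m)) :
    dR (2 * m) δ a b (yInv (2 * m) i j) =
      yInv (2 * m) i b * yInv (2 * m) a j - yInv (2 * m) i a * yInv (2 * m) b j := by
  set Y := yInv (2 * m) with hYd
  set G : Fin (2 * m) → Fin (2 * m) → SPf (2 * m) :=
    fun s c => algebraMap (PS (2 * m)) (SPf (2 * m)) (genEntry (2 * m) s c) with hG
  set D := dR (2 * m) δ a b with hDd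
  have hDG : ∀ s c, D (G s c) =
      (if s = a ∧ c = b then 1 else 0) - (if s = b ∧ c = a then 1 else 0) := by
    intro s c
    rw [hDd, hG, dR_algebraMap _ _ hδ, dE_genEntry, map_sub, apply_ite (algebraMap _ _),
      apply_ite (algebraMap _ _), map_one, map_zero]
  have h1 : ∀ s, ∑ c, G s c * D (Y c j) = - ∑ c, D (G s c) * Y c j := by
    intro s
    have h := congrArg D (gen_mul_yInv m s j)
    have h0 : D (if s = j then 1 else 0) = 0 := by split_ifs <;> simp
    rw [h0, map_sum] at h
    simp only [Derivation.leibniz, smul_eq_mul] at h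
    rw [Finset.sum_add_distrib] at h
    rw [eq_neg_iff_add_eq_zero, ← h]
    congr 1
    exact Finset.sum_congr rfl fun c _ => mul_comm _ _
  have h2 : D (Y i j) = ∑ s, Y i s * ∑ c, G s c * D (Y c j) := by
    simp only [Finset.mul_sum, ← mul_assoc]
    rw [Finset.sum_comm]
    simp only [← Finset.sum_mul]
    have : ∀ c, ∑ s, Y i s * G s c = if i = c then 1 else 0 := fun c => yInv_mul_gen m i c
    simp [this]
  rw [h2]
  simp only [h1, hDG, sub_mul, Finset.sum_sub_distrib, ite_and]
  simp only [ite_mul, one_mul, zero_mul]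
  have h3 : ∀ (s x y : Fin (2 * m)), (∑ c, if s = x then (if c = y then Y c j else 0) else 0) =
      if s = x then Y y j else 0 := by
    intro s x y
    split_ifs <;> simp
  simp only [h3]
  simp [mul_sub]

lemma genEntry_mem (n : ℕ) (i j : Fin n) : genEntry n i j ∈ mIdeal n := by
  rw [mIdeal, RingHom.mem_ker, evalMat, genEntry]
  split_ifs <;> simp

lemma self_mem_dSpan (n : ℕ) (δ : SkewIdx n → Derivation ℂ (SPf n) (SPf n)) (v : SPf n) :
    v ∈ dSpan n δ v := by
  rw [dSpan, Submodule.mem_sInf]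
  exact fun N hN => hN.1

lemma dSpan_stable (n : ℕ) (δ : SkewIdx n → Derivation ℂ (SPf n) (SPf n)) (v : SPf n) :
    DStable n δ (dSpan n δ v) := by
  intro p x hx
  rw [dSpan, Submodule.mem_sInf] at hx ⊢
  exact fun N hN => hN.2 p x (hx N hN)

lemma inclusion_mem (m : ℕ) (δ : SkewIdx (2 * m) → Derivation ℂ (SPf (2 * m)) (SPf (2 * m)))
    (hδ : IsDerivExtension (2 * m) δ) (k : ℕ) (hk : k + 2 ≤ m)
    (hle : dSpan (2 * m) δ (pfInv (2 * m) ^ (2 * k)) ≤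
      dSpan (2 * m) δ (pfInv (2 * m) ^ (2 * k + 2))) (t : ℕ) :
    Submodule.inclusion hle ∈ (mIdeal (2 * m) ^ t) • (⊤ : Submodule (PS (2 * m))
      (↥(dSpan (2 * m) δ (pfInv (2 * m) ^ (2 * k))) →ₗ[PS (2 * m)]
        ↥(dSpan (2 * m) δ (pfInv (2 * m) ^ (2 * k + 2))))) := by
  let i0 : Fin (2 * m) := ⟨0, by omega⟩
  let c0 : Fin (k + 1) := 0
  have hDY := dR_yInv m δ hδ
  have hDp := dR_pfInv (2 * m) δ hδ
  refine incl_mem_pow_smul_hom (mIdeal (2 * m)) (fun j => genEntry (2 * m) j i0)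
    (fun j => yInv (2 * m) i0 j) (fun j => genEntry_mem _ _ _) ?_ _
    (nMod (PS (2 * m)) c0 i0 (yInv (2 * m)) (pfInv (2 * m)) k) _ ?_ ?_ ?_ hle t
  · have h := yInv_mul_gen m i0 i0
    rw [if_pos rfl] at h
    rw [← h]
    exact Finset.sum_congr rfl fun j _ => (Algebra.smul_def _ _).trans (mul_comm _ _)
  · intro j z hz
    exact nMod_stable c0 i0 (yInv (2 * m)) (pfInv (2 * m)) k j z hz
  · refine le_trans ?_ (uMod_le_nMod c0 i0 (yInv (2 * m)) (pfInv (2 * m)) k)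
    refine sInf_le ⟨self_mem_uMod c0 _ _ k, ?_⟩
    rintro ⟨⟨a, b⟩, hab⟩ x hx
    have h1 : δ ⟨(a, b), hab⟩ = dR (2 * m) δ a b := by rw [dR, dif_pos hab]
    rw [h1]
    exact uMod_stable c0 _ (yInv_skew _) _ a b (hDY a b) _ (hDp a b)
      (fun s => ⟨_, dR_algebraMap _ δ hδ a b s⟩) k (Fintype.card_fin _) x hx
  · exact nMod_le c0 i0 _ (yInv_skew _) (dR (2 * m) δ) hDY _ hDp (pfaffian (2 * m))
      (pf_mul_inv _) k (Fintype.card_fin _) _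
      (fun a b x hx => dR_mem _ δ _ (dSpan_stable _ _ _) a b x hx) (self_mem_dSpan _ _ _)

end PartF

end SkewLC

namespace SkewLC

open CategoryTheory

/-- Let `n = 2m` be even.  For all `0 ≤ k ≤ m-2` and all
`j ≥ 0`, the map `H^j_{{0}}(⟨Pf^{-2k}⟩_𝒟) → H^j_{{0}}(⟨Pf^{-2k-2}⟩_𝒟)`
induced by the inclusion `⟨Pf^{-2k}⟩_𝒟 ⊆ ⟨Pf^{-2k-2}⟩_𝒟` is the zero map.
Here `δ` is the family of partial derivatives extended to `S_Pf`,
`⟨Pf^{-2k}⟩_𝒟 = dSpan n δ (pfInv n ^ (2k))`, and the (true) inclusion is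
supplied as the hypothesis `hle`. -/
theorem localCohomology_dSpan_map_eq_zero
    (m : ℕ) (hm : 1 ≤ m) (n : ℕ) (hn : n = 2 * m)
    (δ : SkewIdx n → Derivation ℂ (SPf n) (SPf n)) (hδ : IsDerivExtension n δ)
    (k : ℕ) (hk : k + 2 ≤ m) (j : ℕ)
    (hle : dSpan n δ (pfInv n ^ (2 * k)) ≤ dSpan n δ (pfInv n ^ (2 * k + 2))) :
    (localCohomology (mIdeal n) j).map
        ((ModuleCat.ofHom (Submodule.inclusion hle)
          : ModuleCat.of (PS n) ↥(dSpan n δ (pfInv n ^ (2 * k))) ⟶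
            ModuleCat.of (PS n) ↥(dSpan n δ (pfInv n ^ (2 * k + 2))))) = 0 := by
  subst hn
  exact localCohomology_map_zero _ j _ (inclusion_mem m δ hδ k hk hle)

end SkewLC
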